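/- arXiv:q-alg/9712031 — 4 statements merged into one kernel-verified Lean document; each statement's English description precedes it below -/
import Mathlib

section
/- Let C be a braided monoidal category and A, X, Y objects of C. Write T_Z : A ⊗ Z ⟶ A ⊗ Z for the double braiding β_{A,Z} followed by β_{Z,A}, and for an object W write τ₀^W for the endomorphism α⁻¹ ≫ (T_W whiskered by the remaining factor) ≫ α. Then the two-colour four-braid (type B) relation holds on A⊗(X⊗Y): the composite [α⁻¹_{A,X,Y} ≫ (T_X ▷ Y) ≫ α_{A,X,Y}] ≫ (A ◁ β_{X,Y}.hom) ≫ [α⁻¹_{A,Y,X} ≫ (T_Y ▷ X) ≫ α_{A,Y,X}] ≫ (A ◁ β_{Y,X}.hom) equals the composite (A ◁ β_{X,Y}.hom) ≫ [α⁻¹_{A,Y,X} ≫ (T_Y ▷ X) ≫ α_{A,Y,X}] ≫ (A ◁ β_{Y,X}.hom) ≫ [α⁻¹_{A,X,Y} ≫ (T_X ▷ Y) ≫ α_{A,X,Y}], where ▷ denotes right whiskering and ◁ denotes left whiskering. -/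
open CategoryTheory MonoidalCategory

/-- The `A`-cylinder twist of `Z`: the double braiding of `A` past `Z`. -/
noncomputable def cylinderTwist {C : Type*} [Category C] [MonoidalCategory C]
    [BraidedCategory C] (A Z : C) : A ⊗ Z ⟶ A ⊗ Z :=
  (β_ A Z).hom ≫ (β_ Z A).hom

/-- The braiding of the first two factors of a right-associated triple tensor product. -/
def braidFirstTwo {C : Type*} [Category C] [MonoidalCategory C] [BraidedCategory C]
    (X Y Z : C) : X ⊗ (Y ⊗ Z) ⟶ Y ⊗ (X ⊗ Z) :=
  (α_ X Y Z).inv ≫ (β_ X Y).hom ▷ Z ≫ (α_ Y X Z).hom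

theorem cylinderTwist_whiskerRight {C : Type*} [Category C] [MonoidalCategory C]
    [BraidedCategory C] (A X Y : C) :
    (α_ A X Y).inv ≫ (cylinderTwist A X ▷ Y) ≫ (α_ A X Y).hom =
      braidFirstTwo A X Y ≫ braidFirstTwo X A Y := by
  simp [cylinderTwist, braidFirstTwo]

theorem braidFirstTwo_yang_baxter {C : Type*} [Category C] [MonoidalCategory C]
    [BraidedCategory C] (X Y Z : C) :
    braidFirstTwo X Y Z ≫ Y ◁ (β_ X Z).hom ≫ braidFirstTwo Y Z X =
      X ◁ (β_ Y Z).hom ≫ braidFirstTwo X Z Y ≫ Z ◁ (β_ X Y).hom := by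
  simpa only [braidFirstTwo, Category.assoc] using BraidedCategory.yang_baxter X Y Z

theorem braidFirstTwo_yang_baxter_assoc {C : Type*} [Category C] [MonoidalCategory C]
    [BraidedCategory C] (X Y Z : C) {W : C} (h : Z ⊗ (Y ⊗ X) ⟶ W) :
    braidFirstTwo X Y Z ≫ Y ◁ (β_ X Z).hom ≫ braidFirstTwo Y Z X ≫ h =
      X ◁ (β_ Y Z).hom ≫ braidFirstTwo X Z Y ≫ Z ◁ (β_ X Y).hom ≫ h := by
  simpa only [Category.assoc] using braidFirstTwo_yang_baxter X Y Z =≫ h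

/-- The two-colour four-braid (type B) relation
`τ₀ σ τ₀ σ = σ τ₀ σ τ₀` on `A ⊗ (X ⊗ Y)`, where `τ₀` is induced by the cylinder twist
and `σ` by the braiding. -/
theorem fourBraid {C : Type*} [Category C] [MonoidalCategory C]
    [BraidedCategory C] (A X Y : C) :
    ((α_ A X Y).inv ≫ (cylinderTwist A X ▷ Y) ≫ (α_ A X Y).hom) ≫
        (A ◁ (β_ X Y).hom) ≫
        ((α_ A Y X).inv ≫ (cylinderTwist A Y ▷ X) ≫ (α_ A Y X).hom) ≫
        (A ◁ (β_ Y X).hom) =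
      (A ◁ (β_ X Y).hom) ≫
        ((α_ A Y X).inv ≫ (cylinderTwist A Y ▷ X) ≫ (α_ A Y X).hom) ≫
        (A ◁ (β_ Y X).hom) ≫
        ((α_ A X Y).inv ≫ (cylinderTwist A X ▷ Y) ≫ (α_ A X Y).hom) := by
  simp only [cylinderTwist_whiskerRight, Category.assoc]
  rw [braidFirstTwo_yang_baxter_assoc X A Y, ← braidFirstTwo_yang_baxter Y X A,
    braidFirstTwo_yang_baxter_assoc A X Y, braidFirstTwo_yang_baxter_assoc Y A X]
end

section
/- Let C be a braided monoidal category, A and X objects of C, and n ≥ 1. Define objects V₀ := A and V_{k+1} := V_k ⊗ X, and automorphisms σ₀, σ₁, …, σ_{n−1} of V_n as follows: σ₀ is the double braiding T_X := β_{A,X}.hom ≫ β_{X,A}.hom on V₁ = A ⊗ X, whiskered on the right by the remaining n−1 factors X; for 1 ≤ i ≤ n−1, σ_i is the automorphism of V_{i+1} = (V_{i−1} ⊗ X) ⊗ X given by α_{V_{i−1},X,X}.hom ≫ (V_{i−1} ◁ β_{X,X}.hom) ≫ α_{V_{i−1},X,X}.inv, whiskered on the right by the remaining n−1−i factors X. Let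 ZB_n be the presented group (in the sense of Mathlib's PresentedGroup) on generators g₀, …, g_{n−1} with relators expressing: g_i g_j = g_j g_i whenever |i−j| > 1; g_i g_j g_i = g_j g_i g_j whenever i, j ≥ 1 and |i−j| = 1; and g₀ g₁ g₀ g₁ = g₁ g₀ g₁ g₀. Then there exists a group homomorphism from ZB_n to the group of automorphisms of V_n in C sending each generator g_i to σ_i; i.e., the automorphisms σ₀, …, σ_{n−1} satisfy all the defining relations of the braid group ZB_n of the cylinder (the braid group of Coxeter type B). -/
open CategoryTheory MonoidalCategory

section

variable {C : Type*} [Category C] [MonoidalCategory C] [BraidedCategory C]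

/-- `cylV A X n = A ⊗ X ⊗ ⋯ ⊗ X` (`n` factors of `X`, left-bracketed). -/
def cylV (A X : C) : ℕ → C
  | 0 => A
  | k + 1 => cylV A X k ⊗ X

/-- The basic braid automorphisms: `cylBase A X 0` is the cylinder twist
(double braiding of `A` past `X`) on `A ⊗ X`; for `i ≥ 1`, `cylBase A X i`
braids the `i`-th and `(i+1)`-st factors of `X` in `cylV A X (i+1)`. -/
noncomputable def cylBase (A X : C) : (i : ℕ) → (cylV A X (i + 1) ≅ cylV A X (i + 1))
  | 0 => β_ A X ≪≫ β_ X A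
  | i + 1 =>
      α_ (cylV A X i) X X ≪≫ whiskerLeftIso (cylV A X i) (β_ X X) ≪≫
        (α_ (cylV A X i) X X).symm

/-- `cylSigma A X i n` is `cylBase A X i` whiskered on the right by the remaining
`n - 1 - i` factors of `X`, an automorphism of `cylV A X n`. -/
noncomputable def cylSigma (A X : C) (i : ℕ) : (n : ℕ) → (cylV A X n ≅ cylV A X n)
  | 0 => Iso.refl _
  | n + 1 =>
      if h : i = n then h ▸ cylBase A X i
      else whiskerRightIso (cylSigma A X i n) X

/-- The relators of the braid group `ZB n` of the cylinder (the braid group of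
Coxeter type B): `gᵢgⱼ = gⱼgᵢ` for `|i−j| > 1`; `gᵢgⱼgᵢ = gⱼgᵢgⱼ` for
`i,j ≥ 1`, `|i−j| = 1`; and `g₀g₁g₀g₁ = g₁g₀g₁g₀`. -/
def zbRelators (n : ℕ) : Set (FreeGroup (Fin n)) :=
  { r | (∃ i j : Fin n, 1 < ((i : ℤ) - (j : ℤ)).natAbs ∧
          r = FreeGroup.of i * FreeGroup.of j * (FreeGroup.of j * FreeGroup.of i)⁻¹) ∨
        (∃ i j : Fin n, 1 ≤ (i : ℕ) ∧ 1 ≤ (j : ℕ) ∧ ((i : ℤ) - (j : ℤ)).natAbs = 1 ∧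
          r = FreeGroup.of i * FreeGroup.of j * FreeGroup.of i *
                (FreeGroup.of j * FreeGroup.of i * FreeGroup.of j)⁻¹) ∨
        (∃ h : 1 < n,
          r = FreeGroup.of (⟨0, Nat.lt_of_lt_of_le Nat.zero_lt_one h.le⟩ : Fin n) *
                FreeGroup.of (⟨1, h⟩ : Fin n) *
                FreeGroup.of (⟨0, Nat.lt_of_lt_of_le Nat.zero_lt_one h.le⟩ : Fin n) *
                FreeGroup.of (⟨1, h⟩ : Fin n) *
                (FreeGroup.of (⟨1, h⟩ : Fin n) *
                  FreeGroup.of (⟨0, Nat.lt_of_lt_of_le Nat.zero_lt_one h.le⟩ : Fin n) *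
                  FreeGroup.of (⟨1, h⟩ : Fin n) *
                  FreeGroup.of (⟨0, Nat.lt_of_lt_of_le Nat.zero_lt_one h.le⟩ : Fin n))⁻¹) }

/-- The braid group of the cylinder, presented by generators `τ₀, …, τ_{n−1}` and
the type B braid relations. -/
def ZB (n : ℕ) : Type := PresentedGroup (zbRelators n)

noncomputable instance (n : ℕ) : Group (ZB n) := by
  unfold ZB; infer_instance

/-- The braiding of two adjacent copies of `X` to the right of `V`. -/
noncomputable def braidRight (V X : C) : Aut ((V ⊗ X) ⊗ X) :=
  α_ V X X ≪≫ whiskerLeftIso V (β_ X X) ≪≫ (α_ V X X).symm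

/-- The double braiding of `V` past `X`. -/
noncomputable def doubleBraiding (V X : C) : Aut (V ⊗ X) :=
  β_ V X ≪≫ β_ X V

/-- Right whiskering by `X`, as a homomorphism of automorphism groups. -/
def whiskerRightAut {D : Type*} [Category D] [MonoidalCategory D] (V X : D) :
    Aut V →* Aut (V ⊗ X) where
  toFun f := whiskerRightIso f X
  map_one' := by ext; exact id_whiskerRight V X
  map_mul' f g := by ext; exact comp_whiskerRight g.hom f.hom X

theorem aut_mul_hom {D : Type*} [Category D] {V : D} (f g : Aut V) :
    (f * g).hom = g.hom ≫ f.hom := rfl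

theorem whiskerRightAut_apply_hom {D : Type*} [Category D] [MonoidalCategory D] (V X : D)
    (f : Aut V) :
    (whiskerRightAut V X f).hom = f.hom ▷ X := rfl

theorem braidRight_hom (V X : C) :
    (braidRight V X).hom = (α_ V X X).hom ≫ V ◁ (β_ X X).hom ≫ (α_ V X X).inv := rfl

theorem doubleBraiding_hom (V X : C) :
    (doubleBraiding V X).hom = (β_ V X).hom ≫ (β_ X V).hom := rfl

theorem whiskerRightAut_commute_braidRight (V X : C) (f : Aut V) :
    Commute (whiskerRightAut _ X (whiskerRightAut _ X f)) (braidRight V X) := by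
  ext
  simp only [aut_mul_hom, whiskerRightAut_apply_hom, braidRight_hom, Category.assoc]
  rw [← associator_inv_naturality_left, whisker_exchange_assoc,
    ← associator_naturality_left_assoc]

theorem braidRight_braid (V X : C) :
    whiskerRightAut _ X (braidRight V X) * braidRight (V ⊗ X) X *
        whiskerRightAut _ X (braidRight V X) =
      braidRight (V ⊗ X) X * whiskerRightAut _ X (braidRight V X) *
        braidRight (V ⊗ X) X := by
  ext
  simp only [aut_mul_hom, whiskerRightAut_apply_hom, braidRight_hom]
  calc
    _ = 𝟙 _ ⊗≫ V ◁ ((β_ X X).hom ▷ X ⊗≫ X ◁ (β_ X X).hom ⊗≫ (β_ X X).hom ▷ X) ⊗≫ 𝟙 _ := by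
      monoidal
    _ = _ := by
      rw [BraidedCategory.yang_baxter']
      monoidal

theorem braidRight_mul_doubleBraiding_mul_braidRight (A X : C) :
    braidRight A X * whiskerRightAut _ X (doubleBraiding A X) * braidRight A X =
      doubleBraiding (A ⊗ X) X := by
  ext
  simp [aut_mul_hom, whiskerRightAut_apply_hom, braidRight_hom, doubleBraiding_hom,
    BraidedCategory.braiding_tensor_left_hom, BraidedCategory.braiding_tensor_right_hom]

theorem whiskerRightAut_commute_doubleBraiding (V X : C) (f : Aut V) :
    Commute (whiskerRightAut _ X f) (doubleBraiding V X) := by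
  ext
  simp [aut_mul_hom, whiskerRightAut_apply_hom, doubleBraiding_hom]

/-- `cylSigma` as an element of the automorphism group. -/
noncomputable abbrev cylAut (A X : C) (i n : ℕ) : Aut (cylV A X n) := cylSigma A X i n

/-- Right whiskering by `X`, from automorphisms of `cylV A X n` to those of `cylV A X (n + 1)`. -/
def cylWhisker (A X : C) (n : ℕ) : Aut (cylV A X n) →* Aut (cylV A X (n + 1)) :=
  whiskerRightAut (cylV A X n) X

theorem cylAut_zero_one (A X : C) :
    cylAut A X 0 1 = doubleBraiding A X := by
  simp [cylAut, cylSigma, cylBase]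
  rfl

theorem cylAut_succ_self (A X : C) (i : ℕ) :
    cylAut A X (i + 1) (i + 2) = braidRight (cylV A X i) X := by
  simp [cylAut, cylSigma, cylBase]
  rfl

theorem cylAut_of_lt (A X : C) {i n : ℕ} (h : i < n) :
    cylAut A X i (n + 1) = cylWhisker A X n (cylAut A X i n) := by
  simp [cylAut, cylSigma, h.ne]
  rfl

theorem cylAut_commute (A X : C) {i j n : ℕ} (hij : i + 1 < j) (hj : j < n) :
    Commute (cylAut A X i n) (cylAut A X j n) := by
  induction n, hj using Nat.le_induction with
  | base =>
    obtain ⟨k, rfl⟩ : ∃ k, j = k + 1 := ⟨j - 1, by omega⟩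
    rw [cylAut_of_lt A X (show i < k + 1 by omega), cylAut_of_lt A X (show i < k by omega)]
    exact cylAut_succ_self A X k ▸ whiskerRightAut_commute_braidRight _ X _
  | succ n hn ih =>
    rw [cylAut_of_lt A X (show i < n by omega), cylAut_of_lt A X (show j < n by omega)]
    exact ih.map _

theorem cylAut_braid (A X : C) {i n : ℕ} (hi : 1 ≤ i) (hn : i + 1 < n) :
    cylAut A X i n * cylAut A X (i + 1) n * cylAut A X i n =
      cylAut A X (i + 1) n * cylAut A X i n * cylAut A X (i + 1) n := by
  induction n, hn using Nat.le_induction with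
  | base =>
    obtain ⟨k, rfl⟩ := Nat.exists_eq_add_of_le' hi
    rw [Nat.succ_eq_add_one, cylAut_of_lt A X (show k + 1 < k + 1 + 1 by omega),
      cylAut_succ_self, cylAut_succ_self]
    exact braidRight_braid _ X
  | succ n hn ih =>
    rw [cylAut_of_lt A X (show i < n by omega), cylAut_of_lt A X (show i + 1 < n by omega)]
    simp only [← map_mul, ih]

theorem cylAut_zero_one_relation (A X : C) {n : ℕ} (hn : 1 < n) :
    cylAut A X 0 n * cylAut A X 1 n * cylAut A X 0 n * cylAut A X 1 n =
      cylAut A X 1 n * cylAut A X 0 n * cylAut A X 1 n * cylAut A X 0 n := by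
  induction n, hn using Nat.le_induction with
  | base =>
    have h := whiskerRightAut_commute_doubleBraiding _ X (doubleBraiding A X)
    rw [← braidRight_mul_doubleBraiding_mul_braidRight] at h
    rw [Nat.succ_eq_add_one, cylAut_of_lt A X one_pos, cylAut_zero_one, cylAut_succ_self]
    simp only [Commute, SemiconjBy, ← mul_assoc] at h
    exact h
  | succ n hn ih =>
    rw [cylAut_of_lt A X (show 0 < n by omega), cylAut_of_lt A X (show 1 < n by omega)]
    simp only [← map_mul, ih]

theorem lift_cylAut_zbRelators (A X : C) (n : ℕ) :
    ∀ r ∈ zbRelators n, FreeGroup.lift (fun i : Fin n => cylAut A X i n) r = 1 := by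
  rintro r (⟨i, j, h, rfl⟩ | ⟨i, j, hi, hj, h, rfl⟩ | ⟨h, rfl⟩) <;>
    rw [map_mul, map_inv, mul_inv_eq_one] <;> simp only [map_mul, FreeGroup.lift_apply_of]
  · rcases lt_or_gt_of_ne (show (i : ℕ) ≠ j by omega) with hij | hij
    · exact cylAut_commute A X (by omega) j.isLt
    · exact (cylAut_commute A X (by omega) i.isLt).symm
  · have hi' := i.isLt
    have hj' := j.isLt
    rcases (show (j : ℕ) = i + 1 ∨ (i : ℕ) = j + 1 by omega) with hij | hij
    · rw [hij]
      exact cylAut_braid A X hi (by omega)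
    · rw [hij]
      exact (cylAut_braid A X hj (by omega)).symm
  · exact cylAut_zero_one_relation A X h

/-- The automorphisms `σ₀, …, σ_{n−1}` of `A ⊗ X^{⊗n}` built from the cylinder
twist and the braiding satisfy the defining relations of the braid group `ZB_n`
of the cylinder: there is a group homomorphism `ZB_n → Aut (A ⊗ X^{⊗n})`
sending the `i`-th generator to `σᵢ`. -/
theorem zb_representation (A X : C) (n : ℕ) (hn : 1 ≤ n) :
    ∃ φ : ZB n →* Aut (cylV A X n),
      ∀ i : Fin n, φ (PresentedGroup.of i) = cylSigma A X (i : ℕ) n := by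
  exact ⟨PresentedGroup.toGroup (lift_cylAut_zbRelators A X n),
    fun _ => PresentedGroup.toGroup.of _⟩

end
end

section
/- In the skein setting, assume: (SK1) c.hom − c.inv = δ • (id_{X⊗X} − d ≫ b); (SK2a) b ≫ c.hom = λ • b; (SK3) b ≫ d = A₀ • id_𝟙; that λ is a unit of R with inverse λ⁻¹; and that b has trivial annihilator (for all s : R, s • b = 0 implies s = 0). Then the parameters satisfy the Kauffman compatibility relation λ − λ⁻¹ = δ·(1 − A₀), i.e. δ − A₀·δ = λ − λ⁻¹ (the relation between δ, λ and A₀ of the usual Kauffman skein theory, here for the cylinder Kauffman polynomial). -/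
open CategoryTheory MonoidalCategory

/-- (Kauffman relation for the cylinder Kauffman polynomial.)
In the skein setting, relations (SK1), (SK2a), (SK3), invertibility of `λ` and
triviality of the annihilator of `b` imply `δ − A₀·δ = λ − λ⁻¹`. -/
theorem skein_delta_relation {R : Type*} [CommRing R]
    {C : Type*} [Category C] [MonoidalCategory C] [Preadditive C] [Linear R C]
    [MonoidalPreadditive C] [MonoidalLinear R C]
    (X : C) (b : 𝟙_ C ⟶ X ⊗ X) (d : X ⊗ X ⟶ 𝟙_ C)
    (c : X ⊗ X ≅ X ⊗ X) (δ lam laminv A₀ : R)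
    (SK1 : c.hom - c.inv = δ • (𝟙 (X ⊗ X) - d ≫ b))
    (SK2a : b ≫ c.hom = lam • b)
    (SK3 : b ≫ d = A₀ • 𝟙 (𝟙_ C))
    (hlam : lam * laminv = 1)
    (hb : ∀ s : R, s • b = 0 → s = 0) :
    δ - A₀ * δ = lam - laminv := by
  have b_inv : b ≫ c.inv = laminv • b := by
    have h : b = lam • (b ≫ c.inv) := by
      rw [← Linear.smul_comp, ← SK2a, Category.assoc, c.hom_inv_id, Category.comp_id]
    calc b ≫ c.inv = laminv • lam • (b ≫ c.inv) := by
          rw [smul_smul, mul_comm, hlam, one_smul]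
      _ = laminv • b := by rw [← h]
  have key : lam • b - laminv • b = δ • (b - A₀ • b) := by
    have h := congrArg (b ≫ ·) SK1
    simpa only [Preadditive.comp_sub, Linear.comp_smul, SK2a, b_inv, Category.comp_id,
      ← Category.assoc, SK3, Linear.smul_comp, Category.id_comp] using h
  refine sub_eq_zero.mp (hb _ ?_)
  rw [sub_smul, sub_smul, sub_smul, key, smul_sub, smul_smul, mul_comm δ A₀, sub_self]
end

section
/- In the skein setting, assume: (SK4) t.inv = α • t.hom + β • id_X + γ • (d⁰ ≫ b⁰); (SK5) b⁰ ≫ d⁰ = x₀ • id_𝟙; the point-axiom t.hom ≫ d⁰ = d⁰ (the copoint absorbs the cylinder twist); and that d⁰ has trivial annihilator (for all s : R, s • d⁰ = 0 implies s = 0). Then α + β + γ·x₀ = 1. -/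
open CategoryTheory MonoidalCategory

/-- In the skein setting, relations (SK4), (SK5), the point-axiom
`t ∘ d0 = d0` and triviality of the annihilator of `d0` imply
`α + β + γ·x₀ = 1`. -/
theorem skein_alpha_beta_gamma_relation {R : Type*} [CommRing R]
    {C : Type*} [Category C] [MonoidalCategory C] [Preadditive C] [Linear R C]
    [MonoidalPreadditive C] [MonoidalLinear R C]
    (X : C) (b0 : 𝟙_ C ⟶ X) (d0 : X ⟶ 𝟙_ C)
    (t : X ≅ X) (alpha beta gamma x₀ : R)
    (SK4 : t.inv = alpha • t.hom + beta • 𝟙 X + gamma • (d0 ≫ b0))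
    (SK5 : b0 ≫ d0 = x₀ • 𝟙 (𝟙_ C))
    (hpt : t.hom ≫ d0 = d0)
    (hd : ∀ s : R, s • d0 = 0 → s = 0) :
    alpha + beta + gamma * x₀ = 1 := by
  have hinv : t.inv ≫ d0 = d0 := by
    rw [Iso.inv_comp_eq, hpt]
  have key : d0 = alpha • d0 + beta • d0 + (gamma * x₀) • d0 := by
    conv_lhs => rw [← hinv, SK4]
    simp [Preadditive.add_comp, Linear.smul_comp, Linear.comp_smul, hpt, SK5, mul_smul]
  refine sub_eq_zero.mp (hd _ ?_)
  rw [sub_smul, add_smul, add_smul, one_smul, ← key, sub_self]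
end
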